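/- For every integer n > 3 and every ε ∈ (0,1), there occurs a bifurcation in the number of rosette central configurations as μ increases: there exist 0 < μ₁ < μ₂ such that for every μ ∈ (0, μ₁) the equation h(x, ε) = μ has at least three solutions x ∈ (0,1) ∪ (1,∞), while for every μ > μ₂ it has exactly one solution x ∈ (0,1) ∪ (1,∞). -/

import Mathlib

/-- `k_n = (1/(4n)) · Σ_{k=1}^{n-1} 1/sin(kπ/n)` -/
noncomputable def kn (n : ℕ) : ℝ :=
  (1 / (4 * n)) * ∑ k ∈ Finset.Icc 1 (n - 1), 1 / Real.sin (k * Real.pi / n)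

/-- `φ_k = (2k-1)π/n`, and `u_k = cos φ_k`. -/
noncomputable def phi (n k : ℕ) : ℝ := (2 * (k : ℝ) - 1) * Real.pi / n

/-- The reduced central configuration function
`h(x, ε) = −n·k_n·(ε−x³)/(1−x³) − (x²/(1−x³))·Σ_{k=1}^{n} [x(1−ε) − (1−εx²)u_k]/(1+x²−2xu_k)^{3/2}`,
where `u_k = cos φ_k`.  Solutions of `h(x, ε) = μ` are the rosette central configurations. -/
noncomputable def h (n : ℕ) (x ε : ℝ) : ℝ :=
  -((n : ℝ) * kn n) * (ε - x ^ 3) / (1 - x ^ 3) -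
    (x ^ 2 / (1 - x ^ 3)) * ∑ k ∈ Finset.Icc 1 n,
      (x * (1 - ε) - (1 - ε * x ^ 2) * Real.cos (phi n k)) /
        (1 + x ^ 2 - 2 * x * Real.cos (phi n k)) ^ ((3 : ℝ) / 2)

section

open Finset

theorem rpow_three_halves {a : ℝ} (ha : 0 ≤ a) : a ^ ((3 : ℝ) / 2) = √a ^ 3 := by
  rw [Real.sqrt_eq_rpow, ← Real.rpow_natCast, ← Real.rpow_mul ha]
  norm_num

/-- Midpoint convexity of the cosecant on `(0, π)`. -/
theorem two_div_sin_le {a d : ℝ} (hd : 0 < d) (hda : d < a) (had : a + d < Real.pi) :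
    2 / Real.sin a ≤ 1 / Real.sin (a - d) + 1 / Real.sin (a + d) := by
  have h1 : 0 < Real.sin a := Real.sin_pos_of_pos_of_lt_pi (by linarith) (by linarith)
  have h2 : 0 < Real.sin (a - d) := Real.sin_pos_of_pos_of_lt_pi (by linarith) (by linarith)
  have h3 : 0 < Real.sin (a + d) := Real.sin_pos_of_pos_of_lt_pi (by linarith) (by linarith)
  have h4 : 0 < Real.cos d := Real.cos_pos_of_mem_Ioo ⟨by linarith, by linarith⟩
  have hp : 0 < Real.sin (a - d) * Real.sin (a + d) := mul_pos h2 h3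
  rw [div_add_div _ _ h2.ne' h3.ne', div_le_div_iff₀ h1 hp]
  have hs := Real.sin_sq_add_cos_sq a
  have hs' := Real.sin_sq_add_cos_sq d
  have e1 : Real.sin (a - d) * Real.sin (a + d) = Real.sin a ^ 2 - Real.sin d ^ 2 := by
    rw [Real.sin_sub, Real.sin_add]
    linear_combination (Real.sin a ^ 2) * hs' - (Real.sin d ^ 2) * hs
  have e2 : 1 * Real.sin (a + d) + Real.sin (a - d) * 1 = 2 * Real.sin a * Real.cos d := by
    rw [Real.sin_sub, Real.sin_add]; ring
  rw [e1, e2]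
  have h5 : Real.cos d ≤ 1 := Real.cos_le_one d
  have h6 : Real.sin a ^ 2 ≤ 1 := by nlinarith [sq_nonneg (Real.cos a)]
  nlinarith [mul_nonneg (sub_nonneg.2 h5) h4.le, mul_nonneg (sub_nonneg.2 h5) (sub_nonneg.2 h6)]

/-- The cosecant of the `j`-th multiple of the half step `π / (2n)`. -/
noncomputable def cscStep (n j : ℕ) : ℝ := 1 / Real.sin (j * Real.pi / (2 * n))

theorem sin_step_pos {n j : ℕ} (hj : 0 < j) (hjn : j < 2 * n) :
    0 < Real.sin (j * Real.pi / (2 * n)) := by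
  have hn : (0 : ℝ) < n := by
    have : 0 < n := by omega
    exact_mod_cast this
  have h1 : (0 : ℝ) < j := by exact_mod_cast hj
  have h2 : (j : ℝ) < 2 * n := by exact_mod_cast hjn
  have := Real.pi_pos
  apply Real.sin_pos_of_pos_of_lt_pi (by positivity)
  rw [div_lt_iff₀ (by positivity)]
  nlinarith

theorem cscStep_pos {n j : ℕ} (hj : 0 < j) (hjn : j < 2 * n) : 0 < cscStep n j :=
  one_div_pos.2 (sin_step_pos hj hjn)

theorem two_mul_cscStep_le {n j : ℕ} (hj : 0 < j) (hjn : j + 2 < 2 * n) :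
    2 * cscStep n (j + 1) ≤ cscStep n j + cscStep n (j + 2) := by
  have hn : (0 : ℝ) < n := by
    have : 0 < n := by omega
    exact_mod_cast this
  have h1 : (0 : ℝ) < j := by exact_mod_cast hj
  have h2 : (j : ℝ) + 2 < 2 * n := by exact_mod_cast hjn
  have hpi := Real.pi_pos
  have key := two_div_sin_le (a := ((j : ℝ) + 1) * Real.pi / (2 * n)) (d := Real.pi / (2 * n))
    (by positivity) (by gcongr; nlinarith)
    (by rw [← add_div, div_lt_iff₀ (by positivity)]; nlinarith)
  unfold cscStep
  push_cast
  rw [show (j : ℝ) * Real.pi / (2 * n) = (j + 1) * Real.pi / (2 * n) - Real.pi / (2 * n) by ring,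
    show ((j : ℝ) + 2) * Real.pi / (2 * n) = (j + 1) * Real.pi / (2 * n) + Real.pi / (2 * n) by ring]
  calc _ = 2 / Real.sin (((j : ℝ) + 1) * Real.pi / (2 * n)) := by ring
    _ ≤ _ := key

theorem sum_Icc_one_eq_range (n : ℕ) (f : ℕ → ℝ) :
    ∑ k ∈ Icc 1 n, f k = ∑ i ∈ range n, f (i + 1) := by
  rw [← Finset.Ico_add_one_right_eq_Icc, Finset.sum_Ico_eq_sum_range]
  simp [add_comm]

theorem four_mul_kn (n : ℕ) (hn : 0 < n) :
    4 * (n * kn n) = ∑ i ∈ range (n - 1), cscStep n (2 * i + 2) := by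
  have h0 : (n : ℝ) ≠ 0 := by positivity
  rw [kn, sum_Icc_one_eq_range]
  rw [show ∀ S : ℝ, 4 * (n * (1 / (4 * n) * S)) = S by intro S; field_simp]
  refine sum_congr rfl fun i _ => ?_
  unfold cscStep
  push_cast
  congr 2
  field_simp

theorem kn_mul_pos {n : ℕ} (hn : 2 ≤ n) : 0 < n * kn n := by
  have := four_mul_kn n (by omega)
  have h2 : 0 < ∑ i ∈ range (n - 1), cscStep n (2 * i + 2) := by
    apply sum_pos
    · intro i hi
      rw [mem_range] at hi
      exact cscStep_pos (by omega) (by omega)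
    · exact ⟨0, by simp; omega⟩
  linarith

/-- The odd-step cosecant sum dominates the even-step one. -/
theorem four_mul_kn_lt {n : ℕ} (hn : 2 ≤ n) :
    4 * (n * kn n) < ∑ i ∈ range n, cscStep n (2 * i + 1) := by
  obtain ⟨m, rfl⟩ : ∃ m, n = m + 2 := ⟨n - 2, by omega⟩
  rw [four_mul_kn _ (by omega)]
  have h1 : ∑ i ∈ range (m + 1), 2 * cscStep (m + 2) (2 * i + 2) ≤
      ∑ i ∈ range (m + 1), (cscStep (m + 2) (2 * i + 1) + cscStep (m + 2) (2 * (i + 1) + 1)) := by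
    refine sum_le_sum fun i hi => ?_
    rw [mem_range] at hi
    exact two_mul_cscStep_le (by omega) (by omega)
  rw [sum_add_distrib, ← mul_sum] at h1
  have h2 := sum_range_succ (fun i => cscStep (m + 2) (2 * i + 1)) (m + 1)
  have h3 := sum_range_succ' (fun i => cscStep (m + 2) (2 * i + 1)) (m + 1)
  have h4 : 0 < cscStep (m + 2) (2 * (m + 1) + 1) := cscStep_pos (by omega) (by omega)
  have h5 : 0 < cscStep (m + 2) (2 * 0 + 1) := cscStep_pos (by omega) (by omega)
  rw [show m + 2 - 1 = m + 1 by omega]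
  have e : m + 1 + 1 = m + 2 := rfl
  rw [e] at h2 h3
  linarith

theorem cscStep_symm {n j : ℕ} (hn : 0 < n) (hj : j ≤ 2 * n) :
    cscStep n (2 * n - j) = cscStep n j := by
  have h0 : (n : ℝ) ≠ 0 := by positivity
  unfold cscStep
  rw [Nat.cast_sub hj]
  push_cast
  rw [show (2 * (n : ℝ) - j) * Real.pi / (2 * n) = Real.pi - j * Real.pi / (2 * n) by
    field_simp, Real.sin_pi_sub]

theorem sum_middle_cscStep_le (m : ℕ) :
    ∑ i ∈ range m, cscStep (m + 2) (2 * i + 3) ≤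
      4 * ((m + 2 : ℕ) * kn (m + 2)) - cscStep (m + 2) 2 := by
  rw [four_mul_kn _ (by omega)]
  have h1 : ∑ i ∈ range m, 2 * cscStep (m + 2) (2 * i + 3) ≤
      ∑ i ∈ range m, (cscStep (m + 2) (2 * i + 2) + cscStep (m + 2) (2 * (i + 1) + 2)) := by
    refine sum_le_sum fun i hi => ?_
    rw [mem_range] at hi
    exact two_mul_cscStep_le (by omega) (by omega)
  rw [sum_add_distrib, ← mul_sum] at h1
  have h2 := sum_range_succ (fun i => cscStep (m + 2) (2 * i + 2)) m
  have h3 := sum_range_succ' (fun i => cscStep (m + 2) (2 * i + 2)) m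
  have h4 : cscStep (m + 2) (2 * m + 2) = cscStep (m + 2) 2 := by
    rw [← cscStep_symm (n := m + 2) (j := 2) (by omega) (by omega)]
    congr 1
  rw [show m + 2 - 1 = m + 1 by omega]
  simp only [mul_zero, zero_add] at h3
  linarith

theorem cscStep_le_cscStep_two {n j : ℕ} (h2 : 2 ≤ j) (hj : j + 2 ≤ 2 * n) :
    cscStep n j ≤ cscStep n 2 := by
  have main : ∀ j : ℕ, 2 ≤ j → j ≤ n → cscStep n j ≤ cscStep n 2 := by
    intro j h2 hjn
    have hn : (0 : ℝ) < n := by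
      have : 0 < n := by omega
      exact_mod_cast this
    have hpi := Real.pi_pos
    have hj' : (j : ℝ) ≤ n := by exact_mod_cast hjn
    apply one_div_le_one_div_of_le (sin_step_pos (by omega) (by omega))
    apply Real.sin_le_sin_of_le_of_le_pi_div_two
    · have : 0 ≤ ((2 : ℕ) : ℝ) * Real.pi / (2 * n) := by positivity
      linarith
    · rw [div_le_div_iff₀ (by positivity) (by positivity)]
      nlinarith
    · gcongr
  rcases le_total j n with hjn | hjn
  · exact main j h2 hjn
  · rw [← cscStep_symm (n := n) (j := j) (by omega) (by omega)]
    exact main _ (by omega) (by omega)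

theorem four_mul_kn_le {n : ℕ} (hn : 2 ≤ n) : 4 * (n * kn n) ≤ (n - 1) * cscStep n 2 := by
  rw [four_mul_kn _ (by omega)]
  refine (sum_le_card_nsmul _ _ (cscStep n 2) fun i hi => ?_).trans_eq ?_
  · rw [mem_range] at hi
    exact cscStep_le_cscStep_two (by omega) (by omega)
  · rw [card_range, nsmul_eq_mul, Nat.cast_sub (by omega)]
    simp

theorem cos_phi_succ (n i : ℕ) :
    Real.cos (phi n (i + 1)) = 1 - 2 * Real.sin (((2 * i + 1 : ℕ) : ℝ) * Real.pi / (2 * n)) ^ 2 := by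
  rw [← Real.cos_two_mul_eq_one_sub]
  unfold phi
  congr 1
  push_cast
  ring

theorem sum_cos_phi {n : ℕ} (hn : 2 ≤ n) : ∑ i ∈ range n, Real.cos (phi n (i + 1)) = 0 := by
  have hn0 : (n : ℝ) ≠ 0 := by positivity
  have hs : 0 < Real.sin (Real.pi / n) := by
    have := sin_step_pos (n := n) (j := 2) (by omega) (by omega)
    convert this using 2
    push_cast
    field_simp
  have h1 : ∀ i ∈ range n, 2 * Real.sin (Real.pi / n) * Real.cos (phi n (i + 1)) =
      Real.sin (2 * ((i + 1 : ℕ) : ℝ) * Real.pi / n) - Real.sin (2 * (i : ℝ) * Real.pi / n) := by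
    intro i _
    rw [Real.sin_sub_sin]
    unfold phi
    push_cast
    congr 1
    · congr 2
      ring
    · congr 1
      ring
  have h2 := sum_congr rfl h1
  rw [← mul_sum, sum_range_sub (fun i : ℕ => Real.sin (2 * (i : ℝ) * Real.pi / n))] at h2
  have h3 : 2 * (n : ℝ) * Real.pi / n = 2 * Real.pi := by field_simp
  rw [h3] at h2
  simp at h2
  rcases h2 with h2 | h2
  · exact absurd h2 hs.ne'
  · exact h2

/-- The squared distance `1 + x² - 2 x u_k`, with `k = i + 1`. -/
noncomputable def sqDist (n i : ℕ) (x : ℝ) : ℝ := 1 + x ^ 2 - 2 * x * Real.cos (phi n (i + 1))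

/-- The numerator of `h` over the common denominator `1 - x³`. -/
noncomputable def hNum (n : ℕ) (ε x : ℝ) : ℝ :=
  n * kn n * (x ^ 3 - ε) - x ^ 2 * ∑ i ∈ range n,
    (x * (1 - ε) - (1 - ε * x ^ 2) * Real.cos (phi n (i + 1))) / sqDist n i x ^ ((3 : ℝ) / 2)

theorem h_eq_hNum_div (n : ℕ) (x ε : ℝ) : h n x ε = hNum n ε x / (1 - x ^ 3) := by
  unfold h hNum sqDist
  rw [sum_Icc_one_eq_range]
  ring

theorem cos_phi_lt_one {n i : ℕ} (hi : i < n) : Real.cos (phi n (i + 1)) < 1 := by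
  rw [cos_phi_succ]
  have := sin_step_pos (n := n) (j := 2 * i + 1) (by omega) (by omega)
  nlinarith

theorem sqDist_pos {n i : ℕ} (hi : i < n) {x : ℝ} (hx : 0 ≤ x) : 0 < sqDist n i x := by
  have h1 := cos_phi_lt_one hi
  unfold sqDist
  rcases hx.eq_or_lt with rfl | hx
  · norm_num
  · nlinarith [sq_nonneg (1 - x), mul_pos hx (sub_pos.2 h1)]

theorem contDiffAt_hNum (n : ℕ) (ε : ℝ) {x : ℝ} (hx : 0 ≤ x) : ContDiffAt ℝ 1 (hNum n ε) x := by
  unfold hNum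
  apply ContDiffAt.sub
  · fun_prop
  · apply ContDiffAt.mul
    · fun_prop
    · apply ContDiffAt.sum
      intro i hi
      have hD := sqDist_pos (mem_range.1 hi) hx
      apply ContDiffAt.div
      · fun_prop
      · apply ContDiffAt.rpow_const_of_ne
        · unfold sqDist
          fun_prop
        · exact hD.ne'
      · exact (Real.rpow_pos_of_pos hD _).ne'

theorem continuousOn_hNum (n : ℕ) (ε : ℝ) : ContinuousOn (hNum n ε) (Set.Ici 0) :=
  fun _ hx => (contDiffAt_hNum n ε hx).continuousAt.continuousWithinAt

theorem hNum_zero (n : ℕ) (ε : ℝ) : hNum n ε 0 = -(n * kn n * ε) := by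
  simp [hNum]

theorem hNum_one_neg {n : ℕ} (hn : 2 ≤ n) {ε : ℝ} (hε : ε < 1) : hNum n ε 1 < 0 := by
  have h1 := four_mul_kn_lt hn
  have h2 : ∀ i ∈ range n, (1 * (1 - ε) - (1 - ε * 1 ^ 2) * Real.cos (phi n (i + 1))) /
      sqDist n i 1 ^ ((3 : ℝ) / 2) = (1 - ε) / 4 * cscStep n (2 * i + 1) := by
    intro i hi
    rw [mem_range] at hi
    have hs := sin_step_pos (n := n) (j := 2 * i + 1) (by omega) (by omega)
    rw [rpow_three_halves (sqDist_pos hi zero_le_one).le]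
    unfold sqDist cscStep
    rw [cos_phi_succ]
    set s := Real.sin (((2 * i + 1 : ℕ) : ℝ) * Real.pi / (2 * n))
    have e : √(1 + 1 ^ 2 - 2 * 1 * (1 - 2 * s ^ 2)) = 2 * s := by
      rw [show 1 + 1 ^ 2 - 2 * 1 * (1 - 2 * s ^ 2) = (2 * s) ^ 2 by ring]
      exact Real.sqrt_sq (by positivity)
    rw [e]
    field_simp
    ring
  unfold hNum
  rw [sum_congr rfl h2, ← mul_sum]
  nlinarith

theorem hNum_bound {n : ℕ} {ε : ℝ} (hε : ε ∈ Set.Ioo (0 : ℝ) 1) {x : ℝ} (hx : 2 ≤ x) :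
    n * kn n * (x ^ 3 - ε) - 24 * n * x ≤ hNum n ε x := by
  obtain ⟨h0, h1⟩ := hε
  have key : ∀ i ∈ range n, (x * (1 - ε) - (1 - ε * x ^ 2) * Real.cos (phi n (i + 1))) /
      sqDist n i x ^ ((3 : ℝ) / 2) ≤ 24 / x := by
    intro i hi
    rw [rpow_three_halves (sqDist_pos (mem_range.1 hi) (by linarith)).le]
    have hc := Real.cos_le_one (phi n (i + 1))
    have hc' := Real.neg_one_le_cos (phi n (i + 1))
    have hr : x / 2 ≤ √(sqDist n i x) := by
      apply Real.le_sqrt_of_sq_le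
      unfold sqDist
      nlinarith
    have hr3 : (x / 2) ^ 3 ≤ √(sqDist n i x) ^ 3 := by gcongr
    have hx3 : 0 < (x / 2) ^ 3 := by positivity
    have hnum : x * (1 - ε) - (1 - ε * x ^ 2) * Real.cos (phi n (i + 1)) ≤ 3 * x ^ 2 := by
      have : |(1 - ε * x ^ 2) * Real.cos (phi n (i + 1))| ≤ (1 + x ^ 2) * 1 := by
        rw [abs_mul]
        apply mul_le_mul _ (abs_le.2 ⟨hc', hc⟩) (abs_nonneg _) (by positivity)
        rw [abs_le]
        constructor <;> nlinarith [sq_nonneg x, mul_nonneg h0.le (sq_nonneg x)]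
      have := abs_le.1 this
      nlinarith
    calc _ ≤ 3 * x ^ 2 / √(sqDist n i x) ^ 3 := by gcongr
      _ ≤ 3 * x ^ 2 / (x / 2) ^ 3 := by gcongr
      _ = 24 / x := by field_simp; ring
  have hsum := sum_le_card_nsmul _ _ _ key
  rw [card_range, nsmul_eq_mul] at hsum
  unfold hNum
  have h2 : x ^ 2 * (n * (24 / x)) = 24 * n * x := by field_simp
  have h3 := mul_le_mul_of_nonneg_left hsum (sq_nonneg x)
  linarith

/-- `hNum` is positive far away from the origin. -/
theorem exists_forall_pos_hNum {n : ℕ} (hn : 2 ≤ n) {ε : ℝ} (hε : ε ∈ Set.Ioo (0 : ℝ) 1) :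
    ∃ M : ℝ, 1 < M ∧ ∀ x, M ≤ x → 0 < hNum n ε x := by
  have hK := kn_mul_pos hn
  refine ⟨2 + 48 * n / (n * kn n), by have : 0 < 48 * n / (n * kn n) := by positivity
                                      linarith, fun x hx => ?_⟩
  have hq : 0 < 48 * n / (n * kn n) := by positivity
  have hx2 : 2 ≤ x := by linarith
  have h1 := hNum_bound (n := n) hε hx2
  have h2 : 48 * (n : ℝ) ≤ n * kn n * x := by
    have : 48 * n / (n * kn n) ≤ x := by linarith
    rw [div_le_iff₀ hK] at this
    linarith
  have h3 : ε ≤ x ^ 3 / 4 := by nlinarith [hε.2, sq_nonneg x]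
  have h4 : 48 * (n : ℝ) * x ≤ n * kn n * x * x := by gcongr
  have h5 : n * kn n * x ^ 2 * 2 ≤ n * kn n * x ^ 2 * x := by gcongr
  have h6 : n * kn n * ε ≤ n * kn n * (x ^ 3 / 4) := by gcongr
  have h7 : 0 < n * kn n * x ^ 3 := by positivity
  nlinarith

/-- Near `1` on the right, a quotient `F / (1 - x³)` with `F` Lipschitz and negative is injective. -/
theorem injOn_div_one_sub_cube {F : ℝ → ℝ} {m L δ : ℝ} (hδ1 : δ ≤ 1)
    (hL : 0 ≤ L) (hLδ : 7 * L * δ < 3 * m)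
    (hm : ∀ x, 1 < x → x < 1 + δ → F x ≤ -m)
    (hlip : ∀ x y, 1 < x → x < y → y < 1 + δ → |F x - F y| ≤ L * |x - y|)
    {x y : ℝ} (hx : 1 < x) (hxy : x < y) (hy : y < 1 + δ) :
    F x / (1 - x ^ 3) ≠ F y / (1 - y ^ 3) := by
  intro he
  have hx3 : 1 < x ^ 3 := one_lt_pow₀ hx (by norm_num)
  have hy3 : 1 < y ^ 3 := one_lt_pow₀ (hx.trans hxy) (by norm_num)
  rw [div_eq_div_iff (by linarith) (by linarith)] at he
  have h1 := hm x hx (hxy.trans hy)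
  have h2 := hlip x y hx hxy hy
  rw [abs_of_neg (sub_neg.2 hxy)] at h2
  have h3 := (abs_le.1 h2).1
  have h4 := (abs_le.1 h2).2
  have e : F x * (y ^ 3 - x ^ 3) = (F x - F y) * (1 - x ^ 3) := by linear_combination -he
  have hm0 : 0 < m := by nlinarith
  have hx7 : x ^ 3 - 1 < 7 * δ := by
    have e1 : x ^ 3 - 1 = (x - 1) * (x ^ 2 + x + 1) := by ring
    have e2 : x ^ 2 + x + 1 ≤ 7 := by nlinarith
    rw [e1]
    nlinarith [mul_le_mul_of_nonneg_left e2 (sub_nonneg.2 hx.le)]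
  have hy3x : 3 * (y - x) ≤ y ^ 3 - x ^ 3 := by
    have e1 : y ^ 3 - x ^ 3 = (y - x) * (y ^ 2 + x * y + x ^ 2) := by ring
    have e2 : 3 ≤ y ^ 2 + x * y + x ^ 2 := by nlinarith
    rw [e1]
    nlinarith [mul_le_mul_of_nonneg_left e2 (sub_nonneg.2 hxy.le)]
  have h5 : F x * (y ^ 3 - x ^ 3) ≤ -m * (3 * (y - x)) := by nlinarith
  have h6 : -(L * (y - x)) * (x ^ 3 - 1) ≤ (F x - F y) * (1 - x ^ 3) := by nlinarith
  have h7 : L * (y - x) * (x ^ 3 - 1) ≤ L * (y - x) * (7 * δ) := by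
    apply mul_le_mul_of_nonneg_left hx7.le
    exact mul_nonneg hL (by linarith)
  nlinarith

/-- Past some level, `h = μ` has only solutions on an interval `(1, 1 + δ)` where `h` is injective. -/
theorem exists_unique_of_large {n : ℕ} (hn : 2 ≤ n) {ε : ℝ} (hε : ε ∈ Set.Ioo (0 : ℝ) 1) :
    ∃ μ₀ : ℝ, ∀ μ x y : ℝ, μ₀ < μ → x ∈ Set.Ioo (0 : ℝ) 1 ∪ Set.Ioi 1 →
      y ∈ Set.Ioo (0 : ℝ) 1 ∪ Set.Ioi 1 → h n x ε = μ → h n y ε = μ → x = y := by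
  have h1 := hNum_one_neg hn hε.2
  set m := -hNum n ε 1 / 2 with hmdef
  have hm0 : 0 < m := by linarith
  have hcd := contDiffAt_hNum n ε zero_le_one
  obtain ⟨L, t, ht, hL⟩ := hcd.exists_lipschitzOnWith
  have hneg : ∀ᶠ x in nhds (1 : ℝ), hNum n ε x < -m :=
    hcd.continuousAt.eventually_lt_const (by linarith)
  obtain ⟨r, hr0, hr⟩ := Metric.eventually_nhds_iff.1 (hneg.and ht)
  obtain ⟨M, hM1, hM⟩ := exists_forall_pos_hNum hn hε
  obtain ⟨δ, hδ0, hδr, hδ1, hδL⟩ : ∃ δ : ℝ, 0 < δ ∧ δ < r ∧ δ < 1 ∧ 7 * (L : ℝ) * δ < 3 * m := by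
    have c1 : ∀ᶠ δ in nhdsWithin (0 : ℝ) (Set.Ioi 0), 7 * (L : ℝ) * δ < 3 * m := by
      apply Filter.Eventually.filter_mono nhdsWithin_le_nhds
      have : ContinuousAt (fun δ : ℝ => 7 * (L : ℝ) * δ) 0 := by fun_prop
      exact this.eventually_lt_const (by simpa using hm0)
    have c2 := Ioo_mem_nhdsGT hr0
    have c3 := Ioo_mem_nhdsGT (zero_lt_one (α := ℝ))
    obtain ⟨δ, a, b, c⟩ := (c1.and (Filter.Eventually.and c2 c3)).exists
    exact ⟨δ, b.1, b.2, c.2, a⟩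
  have hcont : ∀ a b : ℝ, 0 ≤ a → (∀ x ∈ Set.Icc a b, x ≠ 1) →
      ContinuousOn (fun x => hNum n ε x / (1 - x ^ 3)) (Set.Icc a b) := by
    intro a b ha hab
    apply ContinuousOn.div
    · exact (continuousOn_hNum n ε).mono fun x hx => ha.trans hx.1
    · fun_prop
    · intro x hx h0
      have hx0 : 0 ≤ x := ha.trans hx.1
      have : (1 - x) * (1 + x + x ^ 2) = 0 := by linear_combination h0
      rcases mul_eq_zero.1 this with h | h
      · exact hab x hx (by linarith)
      · nlinarith
  obtain ⟨C₁, hC₁⟩ := isCompact_Icc.bddAbove_image (hcont 0 (1 - δ) le_rfl (by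
    intro x hx; have := hx.2; intro h; linarith))
  obtain ⟨C₂, hC₂⟩ := isCompact_Icc.bddAbove_image (hcont (1 + δ) M (by linarith) (by
    intro x hx; have := hx.1; intro h; linarith))
  have hnear : ∀ x, |x - 1| < r → hNum n ε x < -m ∧ x ∈ t := fun x hx => hr (by
    rwa [Real.dist_eq])
  have hloc : ∀ μ x, max (max C₁ C₂) 0 < μ → x ∈ Set.Ioo (0 : ℝ) 1 ∪ Set.Ioi 1 →
      h n x ε = μ → 1 < x ∧ x < 1 + δ := by
    intro μ x hμ hx hh
    rw [h_eq_hNum_div] at hh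
    have hμ0 := (le_max_right _ _).trans_lt hμ
    have hμ1 := ((le_max_left C₁ C₂).trans (le_max_left _ _)).trans_lt hμ
    have hμ2 := ((le_max_right C₁ C₂).trans (le_max_left _ _)).trans_lt hμ
    rcases hx with hx | hx
    · exfalso
      rcases le_total x (1 - δ) with hxd | hxd
      · have := hC₁ ⟨x, ⟨hx.1.le, hxd⟩, rfl⟩
        dsimp only at this
        linarith
      · have h2 := (hnear x (by rw [abs_lt]; constructor <;> linarith [hx.2])).1
        have h3 : x ^ 3 < 1 := pow_lt_one₀ hx.1.le hx.2 (by norm_num)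
        have : hNum n ε x / (1 - x ^ 3) < 0 := div_neg_of_neg_of_pos (by linarith) (by linarith)
        linarith
    · have hx1 : 1 < x := hx
      refine ⟨hx1, ?_⟩
      by_contra! hxd
      rcases le_total x M with hxM | hxM
      · have := hC₂ ⟨x, ⟨hxd, hxM⟩, rfl⟩
        dsimp only at this
        linarith
      · have h2 := hM x hxM
        have h3 : 1 < x ^ 3 := one_lt_pow₀ hx1 (by norm_num)
        have : hNum n ε x / (1 - x ^ 3) < 0 := div_neg_of_pos_of_neg h2 (by linarith)
        linarith
  refine ⟨max (max C₁ C₂) 0, fun μ x y hμ hx hy hhx hhy => ?_⟩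
  obtain ⟨hx1, hx2⟩ := hloc μ x hμ hx hhx
  obtain ⟨hy1, hy2⟩ := hloc μ y hμ hy hhy
  have hinj : ∀ x y : ℝ, 1 < x → x < y → y < 1 + δ →
      hNum n ε x / (1 - x ^ 3) ≠ hNum n ε y / (1 - y ^ 3) := by
    intro x y hx hxy hy
    apply injOn_div_one_sub_cube hδ1.le L.2 hδL _ _ hx hxy hy
    · intro x hx hx'
      exact (hnear x (by rw [abs_lt]; constructor <;> linarith)).1.le
    · intro x y hx hxy hy
      have := hL.dist_le_mul x (hnear x (by rw [abs_lt]; constructor <;> linarith)).2 y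
        (hnear y (by rw [abs_lt]; constructor <;> linarith)).2
      simpa [Real.dist_eq] using this
  rw [h_eq_hNum_div] at hhx hhy
  rcases lt_trichotomy x y with hlt | heq | hlt
  · exact absurd (hhx.trans hhy.symm) (hinj x y hx1 hlt hy2)
  · exact heq
  · exact absurd (hhy.trans hhx.symm) (hinj y x hy1 hlt hx2)

theorem continuousOn_hNum_sub (n : ℕ) (ε μ : ℝ) :
    ContinuousOn (fun x => hNum n ε x - μ * (1 - x ^ 3)) (Set.Ici 0) :=
  (continuousOn_hNum n ε).sub (by fun_prop)

theorem h_eq_of_hNum {n : ℕ} {ε μ x : ℝ} (hx : x ^ 3 ≠ 1)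
    (h0 : hNum n ε x - μ * (1 - x ^ 3) = 0) : h n x ε = μ := by
  rw [h_eq_hNum_div, div_eq_iff (sub_ne_zero.2 hx.symm)]
  linarith

/-- For every `μ > 0` there is a solution to the right of `1`. -/
theorem exists_solution_gt_one {n : ℕ} (hn : 2 ≤ n) {ε μ : ℝ} (hε : ε ∈ Set.Ioo (0 : ℝ) 1)
    (hμ : 0 < μ) : ∃ x, 1 < x ∧ h n x ε = μ := by
  obtain ⟨M, hM1, hM⟩ := exists_forall_pos_hNum hn hε
  have h1 := hNum_one_neg hn hε.2
  have h2 := hM M le_rfl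
  have h3 : 1 < M ^ 3 := one_lt_pow₀ hM1 (by norm_num)
  obtain ⟨x, hx, hx0⟩ := intermediate_value_Ioo hM1.le
    ((continuousOn_hNum_sub n ε μ).mono fun x hx => zero_le_one.trans hx.1)
    (show (0 : ℝ) ∈ _ from ⟨by norm_num; exact h1, by nlinarith⟩)
  exact ⟨x, hx.1, h_eq_of_hNum (one_lt_pow₀ hx.1 (by norm_num)).ne' hx0⟩

/-- If `h` takes a positive value at some point of `(0, 1)`, then every smaller positive value is
attained twice on `(0, 1)`. -/
theorem exists_two_solutions_lt_one {n : ℕ} (hn : 2 ≤ n) {ε μ x₀ : ℝ}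
    (hε : ε ∈ Set.Ioo (0 : ℝ) 1) (hμ : 0 < μ) (hx₀ : x₀ ∈ Set.Ioo (0 : ℝ) 1)
    (hμx : μ < h n x₀ ε) :
    ∃ x y, x ∈ Set.Ioo (0 : ℝ) 1 ∧ y ∈ Set.Ioo (0 : ℝ) 1 ∧ x < y ∧ h n x ε = μ ∧ h n y ε = μ := by
  have hK := kn_mul_pos hn
  have h1 := hNum_one_neg hn hε.2
  have h0 := hNum_zero n ε
  have hKε := mul_pos hK hε.1
  have h3 : x₀ ^ 3 < 1 := pow_lt_one₀ hx₀.1.le hx₀.2 (by norm_num)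
  rw [h_eq_hNum_div, lt_div_iff₀ (by linarith)] at hμx
  obtain ⟨x, hx, hx0⟩ := intermediate_value_Ioo hx₀.1.le
    ((continuousOn_hNum_sub n ε μ).mono fun x hx => hx.1)
    (show (0 : ℝ) ∈ _ from ⟨by rw [h0]; norm_num; linarith, by linarith⟩)
  obtain ⟨y, hy, hy0⟩ := intermediate_value_Ioo' hx₀.2.le
    ((continuousOn_hNum_sub n ε μ).mono fun x hx => hx₀.1.le.trans hx.1)
    (show (0 : ℝ) ∈ _ from ⟨by norm_num; exact h1, by linarith⟩)
  have hx1 := hx.2.trans hx₀.2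
  have hy1 := hx₀.1.trans hy.1
  exact ⟨x, y, ⟨hx.1, hx1⟩, ⟨hy1, hy.2⟩, hx.2.trans hy.1,
    h_eq_of_hNum (pow_lt_one₀ hx.1.le hx1 (by norm_num)).ne hx0,
    h_eq_of_hNum (pow_lt_one₀ hy1.le hy.2 (by norm_num)).ne hy0⟩

/-- The sum governing `hNum` at `ε = 0`. -/
noncomputable def radialSum (n : ℕ) (x : ℝ) : ℝ :=
  ∑ i ∈ range n, (Real.cos (phi n (i + 1)) - x) / √(sqDist n i x) ^ 3

/-- The sum governing `hNum` at `ε = 1`. -/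
noncomputable def cosSum (n : ℕ) (x : ℝ) : ℝ :=
  ∑ i ∈ range n, Real.cos (phi n (i + 1)) / √(sqDist n i x) ^ 3

theorem hNum_eq (n : ℕ) (ε : ℝ) {x : ℝ} (hx : 0 ≤ x) :
    hNum n ε x = (1 - ε) * (x ^ 2 * (n * kn n * x + radialSum n x)) +
      ε * ((1 - x) * (x ^ 2 * (1 + x) * cosSum n x - n * kn n * (1 + x + x ^ 2))) := by
  have h1 : ∀ i ∈ range n, (x * (1 - ε) - (1 - ε * x ^ 2) * Real.cos (phi n (i + 1))) /
      sqDist n i x ^ ((3 : ℝ) / 2) =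
      -(1 - ε) * ((Real.cos (phi n (i + 1)) - x) / √(sqDist n i x) ^ 3) -
        ε * (1 - x ^ 2) * (Real.cos (phi n (i + 1)) / √(sqDist n i x) ^ 3) := by
    intro i hi
    rw [rpow_three_halves (sqDist_pos (mem_range.1 hi) hx).le]
    ring
  unfold hNum
  rw [sum_congr rfl h1, sum_sub_distrib, ← mul_sum, ← mul_sum]
  unfold radialSum cosSum
  ring

theorem hNum_pos {n : ℕ} {ε x : ℝ} (hε : ε ∈ Set.Ioo (0 : ℝ) 1) (hx : x ∈ Set.Ioo (0 : ℝ) 1)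
    (hA : 0 < n * kn n * x + radialSum n x)
    (hB : n * kn n * (1 + x + x ^ 2) < x ^ 2 * (1 + x) * cosSum n x) : 0 < hNum n ε x := by
  rw [hNum_eq n ε hx.1.le]
  have h1 := sub_pos.2 hε.2
  have h2 := hε.1
  have h3 := sub_pos.2 hx.2
  have h4 := hx.1
  have h5 := sub_pos.2 hB
  positivity

theorem cos_phi_last (m : ℕ) : Real.cos (phi (m + 2) (m + 1 + 1)) = Real.cos (phi (m + 2) (0 + 1)) := by
  have h0 : ((m : ℝ) + 2) ≠ 0 := by positivity
  rw [← Real.cos_two_pi_sub]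
  congr 1
  unfold phi
  push_cast
  field_simp
  ring

theorem sqDist_last (m : ℕ) (x : ℝ) : sqDist (m + 2) (m + 1) x = sqDist (m + 2) 0 x := by
  unfold sqDist
  rw [cos_phi_last]

theorem sum_range_add_two (m : ℕ) (f : ℕ → ℝ) :
    ∑ i ∈ range (m + 2), f i = f 0 + f (m + 1) + ∑ i ∈ range m, f (i + 1) := by
  rw [sum_range_succ, sum_range_succ']
  ring

theorem radialSum_ge (m : ℕ) {x : ℝ} (hx : 0 < x) (hx1 : x ≤ 1) :
    2 * ((Real.cos (phi (m + 2) 1) - x) / √(sqDist (m + 2) 0 x) ^ 3) -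
      (4 * ((m + 2 : ℕ) * kn (m + 2)) - cscStep (m + 2) 2) / (4 * √x ^ 3) ≤
      radialSum (m + 2) x := by
  have hy : 0 < √x := Real.sqrt_pos.2 hx
  have hyy : √x ^ 2 = x := Real.sq_sqrt hx.le
  have key : ∀ i ∈ range m, -(1 / (4 * √x ^ 3)) * cscStep (m + 2) (2 * i + 3) ≤
      (Real.cos (phi (m + 2) (i + 1 + 1)) - x) / √(sqDist (m + 2) (i + 1) x) ^ 3 := by
    intro i hi
    rw [mem_range] at hi
    have hD := sqDist_pos (n := m + 2) (i := i + 1) (by omega) hx.le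
    have hs := sin_step_pos (n := m + 2) (j := 2 * (i + 1) + 1) (by omega) (by omega)
    have hr : 0 < √(sqDist (m + 2) (i + 1) x) := Real.sqrt_pos.2 hD
    have hrr : √(sqDist (m + 2) (i + 1) x) ^ 2 = sqDist (m + 2) (i + 1) x := Real.sq_sqrt hD.le
    have hDe := cos_phi_succ (m + 2) (i + 1) ▸ sqDist.eq_def (m + 2) (i + 1) x
    unfold cscStep
    rw [cos_phi_succ]
    change -(1 / (4 * √x ^ 3)) *
      (1 / Real.sin (((2 * (i + 1) + 1 : ℕ) : ℝ) * Real.pi / (2 * ((m + 2 : ℕ) : ℝ)))) ≤ _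
    set s := Real.sin (((2 * (i + 1) + 1 : ℕ) : ℝ) * Real.pi / (2 * ((m + 2 : ℕ) : ℝ)))
    set r := √(sqDist (m + 2) (i + 1) x)
    set y := √x
    have h1 : 2 * y * s ≤ r := by
      apply Real.le_sqrt_of_sq_le
      rw [hDe, mul_pow, mul_pow, hyy]
      nlinarith [sq_nonneg (1 - x)]
    have h2 : 2 * y ^ 2 * (x - (1 - 2 * s ^ 2)) ≤ r ^ 2 := by
      rw [hrr, hDe, hyy]
      nlinarith
    have h3 : (x - (1 - 2 * s ^ 2)) / r ^ 3 ≤ 1 / (4 * y ^ 3 * s) := by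
      rw [div_le_div_iff₀ (by positivity) (by positivity)]
      calc (x - (1 - 2 * s ^ 2)) * (4 * y ^ 3 * s)
          = 2 * y ^ 2 * (x - (1 - 2 * s ^ 2)) * (2 * y * s) := by ring
        _ ≤ r ^ 2 * (2 * y * s) := by gcongr
        _ ≤ r ^ 2 * r := by gcongr
        _ = 1 * r ^ 3 := by ring
    have e1 : -(1 / (4 * y ^ 3)) * (1 / s) = -(1 / (4 * y ^ 3 * s)) := by field_simp
    have e2 : (1 - 2 * s ^ 2 - x) / r ^ 3 = -((x - (1 - 2 * s ^ 2)) / r ^ 3) := by ring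
    rw [e1, e2]
    linarith
  have h1 := sum_le_sum key
  rw [← mul_sum] at h1
  have h2 := sum_middle_cscStep_le m
  have h3 : 0 ≤ 1 / (4 * √x ^ 3) := by positivity
  have h4 := mul_le_mul_of_nonneg_left h2 h3
  unfold radialSum
  rw [sum_range_add_two, sqDist_last, cos_phi_last]
  rw [div_eq_mul_one_div (4 * (((m + 2 : ℕ) : ℝ) * kn (m + 2)) - cscStep (m + 2) 2)]
  simp only [zero_add] at *
  linarith

theorem cosSum_ge (m : ℕ) {x : ℝ} (hx : 0 < x) :
    2 * Real.cos (phi (m + 2) 1) * (1 / √(sqDist (m + 2) 0 x) ^ 3 - 1 / √(1 + x ^ 2) ^ 3) ≤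
      cosSum (m + 2) x := by
  have key : ∀ i ∈ range (m + 2), 0 ≤ Real.cos (phi (m + 2) (i + 1)) *
      (1 / √(sqDist (m + 2) i x) ^ 3 - 1 / √(1 + x ^ 2) ^ 3) := by
    intro i hi
    have hD := sqDist_pos (mem_range.1 hi) hx.le
    have hr : 0 < √(sqDist (m + 2) i x) := Real.sqrt_pos.2 hD
    have hr' : 0 < √(1 + x ^ 2) := Real.sqrt_pos.2 (by positivity)
    rcases le_total 0 (Real.cos (phi (m + 2) (i + 1))) with hc | hc
    · apply mul_nonneg hc
      rw [sub_nonneg]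
      apply one_div_le_one_div_of_le (by positivity)
      gcongr
      unfold sqDist
      nlinarith
    · apply mul_nonneg_of_nonpos_of_nonpos hc
      rw [sub_nonpos]
      apply one_div_le_one_div_of_le (by positivity)
      gcongr
      unfold sqDist
      nlinarith
  have h0 : cosSum (m + 2) x = ∑ i ∈ range (m + 2), Real.cos (phi (m + 2) (i + 1)) *
      (1 / √(sqDist (m + 2) i x) ^ 3 - 1 / √(1 + x ^ 2) ^ 3) := by
    simp only [mul_sub]
    rw [sum_sub_distrib, ← sum_mul, sum_cos_phi (by omega)]
    unfold cosSum
    simp only [mul_one_div, zero_div, sub_zero]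
  rw [h0, sum_range_add_two, sqDist_last, cos_phi_last]
  have h1 : 0 ≤ ∑ i ∈ range m, Real.cos (phi (m + 2) (i + 1 + 1)) *
      (1 / √(sqDist (m + 2) (i + 1) x) ^ 3 - 1 / √(1 + x ^ 2) ^ 3) := by
    refine sum_nonneg fun i hi => key (i + 1) ?_
    simp only [mem_range] at hi ⊢
    omega
  simp only [zero_add] at *
  linarith

theorem sqrt_cube_le {a b : ℝ} (ha : 0 ≤ a) (hb : 0 ≤ b) (h : a ≤ b ^ 2) : √a ^ 3 ≤ a * b := by
  have h1 : √a ≤ b := Real.sqrt_le_iff.2 ⟨hb, h⟩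
  calc √a ^ 3 = √a ^ 2 * √a := by ring
    _ = a * √a := by rw [Real.sq_sqrt ha]
    _ ≤ a * b := by gcongr

theorem le_sqrt_cube {a b : ℝ} (ha : 0 ≤ a) (h : b ^ 2 ≤ a) : a * b ≤ √a ^ 3 := by
  have h1 : b ≤ √a := Real.le_sqrt_of_sq_le h
  calc a * b ≤ a * √a := by gcongr
    _ = √a ^ 2 * √a := by rw [Real.sq_sqrt ha]
    _ = √a ^ 3 := by ring

theorem exists_point_four : 0 < (4 : ℕ) * kn 4 * 0.65 + radialSum 4 0.65 ∧
    (4 : ℕ) * kn 4 * (1 + 0.65 + 0.65 ^ 2) < 0.65 ^ 2 * (1 + 0.65) * cosSum 4 0.65 := by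
  have hq : √2 ^ 2 = 2 := Real.sq_sqrt (by norm_num)
  have hq0 : 1.4142 ≤ √2 := Real.le_sqrt_of_sq_le (by norm_num)
  have hq1 : √2 ≤ 1.41422 := Real.sqrt_le_iff.2 (by norm_num)
  have c0 : Real.cos (phi 4 1) = √2 / 2 := by
    rw [← Real.cos_pi_div_four]; congr 1; unfold phi; push_cast; ring
  have c1 : Real.cos (phi 4 2) = -(√2 / 2) := by
    rw [← Real.cos_pi_div_four, ← Real.cos_pi_sub]; congr 1; unfold phi; push_cast; ring
  have c2 : Real.cos (phi 4 3) = -(√2 / 2) := by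
    rw [← Real.cos_pi_div_four, ← Real.cos_add_pi]; congr 1; unfold phi; push_cast; ring
  have c3 : Real.cos (phi 4 4) = √2 / 2 := by
    rw [← Real.cos_pi_div_four, ← Real.cos_two_pi_sub]; congr 1; unfold phi; push_cast; ring
  have hC : cscStep 4 2 = √2 := by
    have : ((2 : ℕ) : ℝ) * Real.pi / (2 * (4 : ℕ)) = Real.pi / 4 := by push_cast; ring
    rw [cscStep, this, Real.sin_pi_div_four]
    field_simp
    linarith
  have hC4 : cscStep 4 4 = 1 := by
    have : ((4 : ℕ) : ℝ) * Real.pi / (2 * (4 : ℕ)) = Real.pi / 2 := by push_cast; ring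
    rw [cscStep, this, Real.sin_pi_div_two, div_one]
  have hC6 : cscStep 4 6 = √2 := by
    rw [← hC, ← cscStep_symm (n := 4) (j := 2) (by norm_num) (by norm_num)]
  have hK := four_mul_kn 4 (by norm_num)
  simp only [Finset.sum_range_succ, Finset.sum_range_zero, Nat.reduceSub, Nat.reduceMul,
    Nat.reduceAdd, hC, hC4, hC6] at hK
  have d0 : sqDist 4 0 0.65 = 1.4225 - 1.3 * (√2 / 2) := by
    unfold sqDist; simp only [Nat.reduceAdd]; rw [c0]; ring
  have hlow : √(1.4225 - 1.3 * (√2 / 2)) ^ 3 ≤ 0.3573 :=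
    (sqrt_cube_le (b := 0.7095) (by linarith) (by norm_num) (by linarith)).trans (by linarith)
  have hlow0 : 0 < √(1.4225 - 1.3 * (√2 / 2)) ^ 3 := by
    have := Real.sqrt_pos.2 (show 0 < 1.4225 - 1.3 * (√2 / 2) by linarith)
    positivity
  have hhigh : 3.58 ≤ √(1.4225 + 1.3 * (√2 / 2)) ^ 3 :=
    le_trans (by linarith) (le_sqrt_cube (b := 1.53) (by linarith) (by linarith))
  constructor
  · have hA : radialSum 4 0.65 = 2 * ((√2 / 2 - 0.65) / √(1.4225 - 1.3 * (√2 / 2)) ^ 3) -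
        2 * ((√2 / 2 + 0.65) / √(1.4225 + 1.3 * (√2 / 2)) ^ 3) := by
      unfold radialSum sqDist
      simp only [Finset.sum_range_succ, Finset.sum_range_zero, Nat.reduceAdd, c0, c1, c2, c3]
      rw [show (1 : ℝ) + 0.65 ^ 2 - 2 * 0.65 * (√2 / 2) = 1.4225 - 1.3 * (√2 / 2) by ring,
        show (1 : ℝ) + 0.65 ^ 2 - 2 * 0.65 * -(√2 / 2) = 1.4225 + 1.3 * (√2 / 2) by ring]
      ring
    have e1 : 0.0571 / 0.3573 ≤ (√2 / 2 - 0.65) / √(1.4225 - 1.3 * (√2 / 2)) ^ 3 := by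
      apply div_le_div₀ <;> linarith
    have e2 : (√2 / 2 + 0.65) / √(1.4225 + 1.3 * (√2 / 2)) ^ 3 ≤ 1.3572 / 3.58 := by
      apply div_le_div₀ <;> linarith
    rw [hA]
    norm_num at e1 e2 hK ⊢
    linarith
  · have hB := cosSum_ge 2 (x := 0.65) (by norm_num)
    simp only [Nat.reduceAdd] at hB
    rw [c0, d0] at hB
    have e1 : 1 / 0.3573 ≤ 1 / √(1.4225 - 1.3 * (√2 / 2)) ^ 3 :=
      one_div_le_one_div_of_le hlow0 hlow
    have e2 : 1 / √((1 : ℝ) + 0.65 ^ 2) ^ 3 ≤ 1 / 1.69 := by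
      apply one_div_le_one_div_of_le (by norm_num)
      exact le_trans (by norm_num) (le_sqrt_cube (b := 1.19) (by norm_num) (by norm_num))
    have e3 : 1.4142 * (1 / 0.3573 - 1 / 1.69) ≤ cosSum 4 0.65 := by
      refine le_trans ?_ hB
      apply mul_le_mul (by linarith) (by linarith) (by norm_num) (by positivity)
    norm_num at e3 hK ⊢
    linarith

theorem exists_point_five : 0 < (5 : ℕ) * kn 5 * 0.65 + radialSum 5 0.65 ∧
    (5 : ℕ) * kn 5 * (1 + 0.65 + 0.65 ^ 2) < 0.65 ^ 2 * (1 + 0.65) * cosSum 5 0.65 := by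
  have hq0 : 2.236 ≤ √5 := Real.le_sqrt_of_sq_le (by norm_num)
  have hq1 : √5 ≤ 2.23607 := Real.sqrt_le_iff.2 (by norm_num)
  have c0 : Real.cos (phi 5 1) = (1 + √5) / 4 := by
    rw [← Real.cos_pi_div_five]; congr 1; unfold phi; push_cast; ring
  have hC : cscStep 5 2 ≤ 1.7015 := by
    have : ((2 : ℕ) : ℝ) * Real.pi / (2 * (5 : ℕ)) = Real.pi / 5 := by push_cast; ring
    have hs := sin_step_pos (n := 5) (j := 2) (by norm_num) (by norm_num)
    rw [cscStep, this]
    rw [this] at hs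
    rw [div_le_iff₀ hs]
    have hsc := Real.sin_sq_add_cos_sq (Real.pi / 5)
    rw [Real.cos_pi_div_five] at hsc
    nlinarith
  have hK := four_mul_kn_le (n := 5) (by norm_num)
  have hK0 := kn_mul_pos (n := 5) (by norm_num)
  have hC0 := cscStep_pos (n := 5) (j := 2) (by norm_num) (by norm_num)
  have d0 : sqDist 5 0 0.65 = 1.4225 - 1.3 * ((1 + √5) / 4) := by
    unfold sqDist; simp only [Nat.reduceAdd]; rw [c0]; ring
  have hlow : √(1.4225 - 1.3 * ((1 + √5) / 4)) ^ 3 ≤ 0.2259 :=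
    (sqrt_cube_le (b := 0.60895) (by linarith) (by norm_num) (by linarith)).trans
      (by linarith)
  have hlow0 : 0 < √(1.4225 - 1.3 * ((1 + √5) / 4)) ^ 3 := by
    have := Real.sqrt_pos.2 (show 0 < 1.4225 - 1.3 * ((1 + √5) / 4) by linarith)
    positivity
  constructor
  · have hA := radialSum_ge 3 (x := 0.65) (by norm_num) (by norm_num)
    simp only [Nat.reduceAdd] at hA
    rw [c0, d0] at hA
    have e1 : 0.159 / 0.2259 ≤
        ((1 + √5) / 4 - 0.65) / √(1.4225 - 1.3 * ((1 + √5) / 4)) ^ 3 := by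
      apply div_le_div₀ <;> linarith
    have hy : 0.524 ≤ √(0.65 : ℝ) ^ 3 :=
      le_trans (by norm_num) (le_sqrt_cube (b := 0.8062) (by norm_num) (by norm_num))
    have e2 : (4 * ((5 : ℕ) * kn 5) - cscStep 5 2) / (4 * √(0.65 : ℝ) ^ 3) ≤
        ((5 : ℕ) * kn 5) * 0.65 + 1.34 := by
      rw [div_le_iff₀ (by positivity)]
      have : (((5 : ℕ) * kn 5) * 0.65 + 1.34) * (4 * 0.524) ≤
        (((5 : ℕ) * kn 5) * 0.65 + 1.34) * (4 * √(0.65 : ℝ) ^ 3) := by gcongr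
      refine le_trans ?_ this
      norm_num at hK hK0 ⊢
      linarith
    norm_num at e1 e2 hA ⊢
    linarith
  · have hB := cosSum_ge 3 (x := 0.65) (by norm_num)
    simp only [Nat.reduceAdd] at hB
    rw [c0, d0] at hB
    have e1 : 1 / 0.2259 ≤ 1 / √(1.4225 - 1.3 * ((1 + √5) / 4)) ^ 3 :=
      one_div_le_one_div_of_le hlow0 hlow
    have e2 : 1 / √((1 : ℝ) + 0.65 ^ 2) ^ 3 ≤ 1 / 1 := by
      apply one_div_le_one_div_of_le (by norm_num)
      exact le_trans (by norm_num) (le_sqrt_cube (b := 1) (by norm_num) (by norm_num))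
    have e3 : 1.618 * (1 / 0.2259 - 1 / 1) ≤ cosSum 5 0.65 := by
      refine le_trans ?_ hB
      apply mul_le_mul (by linarith) (by linarith) (by norm_num) (by positivity)
    norm_num at e3 hK ⊢
    linarith

set_option maxHeartbeats 1000000 in
theorem exists_point_large (m : ℕ) (hm : 4 ≤ m) : ∃ x ∈ Set.Ioo (0 : ℝ) 1,
    0 < (m + 2 : ℕ) * kn (m + 2) * x + radialSum (m + 2) x ∧
    (m + 2 : ℕ) * kn (m + 2) * (1 + x + x ^ 2) < x ^ 2 * (1 + x) * cosSum (m + 2) x := by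
  have hn : (6 : ℝ) ≤ (m + 2 : ℕ) := by exact_mod_cast (by omega : 6 ≤ m + 2)
  have hs0 : 0 < Real.sin (Real.pi / (2 * (m + 2 : ℕ))) := by
    have := sin_step_pos (n := m + 2) (j := 1) (by omega) (by omega)
    simpa using this
  have hpi := Real.pi_pos
  have hpi' := Real.pi_lt_d4
  have hst : Real.sin (Real.pi / (2 * (m + 2 : ℕ))) ≤ Real.pi / (2 * (m + 2 : ℕ)) :=
    Real.sin_le (by positivity)
  have hns : ((m + 2 : ℕ) : ℝ) * Real.sin (Real.pi / (2 * (m + 2 : ℕ))) ≤ 1.571 := by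
    rw [le_div_iff₀ (by positivity)] at hst
    linarith
  have hs1 : Real.sin (Real.pi / (2 * (m + 2 : ℕ))) ≤ 0.2619 := by nlinarith
  have hcs := Real.sin_sq_add_cos_sq (Real.pi / (2 * (m + 2 : ℕ)))
  have hc0 : 0 < Real.cos (Real.pi / (2 * (m + 2 : ℕ))) := by
    apply Real.cos_pos_of_mem_Ioo
    constructor
    · have : 0 < Real.pi / (2 * (m + 2 : ℕ)) := by positivity
      linarith
    · gcongr
      linarith
  have hc1 := Real.cos_le_one (Real.pi / (2 * (m + 2 : ℕ)))
  have hC : cscStep (m + 2) 2 = 1 / (2 * Real.sin (Real.pi / (2 * (m + 2 : ℕ))) *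
      Real.cos (Real.pi / (2 * (m + 2 : ℕ)))) := by
    rw [cscStep, ← Real.sin_two_mul]
    congr 2
    push_cast
    ring
  have hu : Real.cos (phi (m + 2) 1) = 1 - 2 * Real.sin (Real.pi / (2 * (m + 2 : ℕ))) ^ 2 := by
    have := cos_phi_succ (m + 2) 0
    simpa using this
  have hK := four_mul_kn_le (n := m + 2) (by omega)
  have hK0 := kn_mul_pos (n := m + 2) (by omega)
  rw [hC] at hK
  set s := Real.sin (Real.pi / (2 * (m + 2 : ℕ)))
  set c := Real.cos (Real.pi / (2 * (m + 2 : ℕ)))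
  set K := ((m + 2 : ℕ) : ℝ) * kn (m + 2)
  have hc2 : 0.965 ≤ c := by nlinarith
  have hKs : K * s ^ 2 ≤ 0.1296 * (1.571 - s) := by
    have h1 : (4 * K) * (2 * s * c) ≤ (m + 2 : ℕ) - 1 := by
      rw [mul_one_div, le_div_iff₀ (by positivity)] at hK
      exact hK
    have h2 : (4 * K) * (2 * s * c) * s ≤ ((m + 2 : ℕ) - 1) * s := by gcongr
    have h3 : 8 * (K * s ^ 2) * 0.965 ≤ 8 * (K * s ^ 2) * c := by gcongr
    nlinarith
  have hCs : s / 8 ≤ s ^ 2 * (cscStep (m + 2) 2 / 4) := by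
    have e : s ^ 2 * (1 / (2 * s * c) / 4) = s / 8 * (1 / c) := by field_simp; ring
    rw [hC, e]
    have : 1 ≤ 1 / c := by rw [le_div_iff₀ hc0]; linarith
    nlinarith
  have hD : √(sqDist (m + 2) 0 (1 - s)) = s * √(5 - 4 * s) := by
    rw [sqDist, zero_add, hu, show 1 + (1 - s) ^ 2 - 2 * (1 - s) * (1 - 2 * s ^ 2) =
      s ^ 2 * (5 - 4 * s) by ring, Real.sqrt_mul (sq_nonneg s), Real.sqrt_sq hs0.le]
  have hw0 : 0 < √(5 - 4 * s) ^ 3 := by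
    have := Real.sqrt_pos.2 (show 0 < 5 - 4 * s by linarith)
    positivity
  have hw : √(5 - 4 * s) ^ 3 ≤ 11.19 - 12.4 * s :=
    (sqrt_cube_le (b := 2.237 - 0.89 * s) (by linarith) (by linarith)
      (by nlinarith)).trans (by nlinarith)
  refine ⟨1 - s, ⟨by linarith, by linarith⟩, ?_, ?_⟩
  · have hA := radialSum_ge m (x := 1 - s) (by linarith) (by linarith)
    rw [hu, hD] at hA
    have hy0 : 0 < √(1 - s) ^ 3 := by
      have := Real.sqrt_pos.2 (show 0 < 1 - s by linarith)
      positivity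
    have hy1 : √(1 - s) ^ 3 ≤ 1 :=
      (sqrt_cube_le (b := 1) (by linarith) (by linarith) (by linarith)).trans (by linarith)
    have hy2 : (1 - s) * (1 - 0.54 * s) ≤ √(1 - s) ^ 3 := le_sqrt_cube (by linarith) (by nlinarith)
    set Y := 1 / √(1 - s) ^ 3 with hY
    have hY1 : 1 ≤ Y := by rw [hY, le_div_iff₀ hy0]; linarith
    have hY2 : Y ≤ 1 + 2.22 * s := by
      rw [hY, div_le_iff₀ hy0]
      have h1 : (1 + 2.22 * s) * ((1 - s) * (1 - 0.54 * s)) ≤ (1 + 2.22 * s) * √(1 - s) ^ 3 := by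
        gcongr
      refine le_trans ?_ h1
      nlinarith [mul_nonneg hs0.le (sub_nonneg.2 hs1), mul_nonneg (mul_nonneg hs0.le hs0.le) (sub_nonneg.2 hs1)]
    have e1 : (4 * K - cscStep (m + 2) 2) / (4 * √(1 - s) ^ 3) = Y * (K - cscStep (m + 2) 2 / 4) := by
      rw [hY]; field_simp
    have e2 : s ^ 2 * (2 * ((1 - 2 * s ^ 2 - (1 - s)) / (s * √(5 - 4 * s)) ^ 3)) =
        2 * (1 - 2 * s) / √(5 - 4 * s) ^ 3 := by
      field_simp
      ring
    have e3 : 2 * (1 - 2 * s) / (11.19 - 12.4 * s) ≤ 2 * (1 - 2 * s) / √(5 - 4 * s) ^ 3 := by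
      gcongr
      linarith
    have e4 : s * (0.532 - 0.417 * s) < 2 * (1 - 2 * s) / (11.19 - 12.4 * s) := by
      rw [lt_div_iff₀ (by linarith)]
      linarith [sq_nonneg (s - 0.26), mul_nonneg (mul_nonneg hs0.le hs0.le) (sub_nonneg.2 hs1)]
    rw [e1] at hA
    have h1 : K * s ^ 2 * (Y - 1 + s) ≤ 0.1296 * (1.571 - s) * (3.22 * s) := by
      apply mul_le_mul hKs (by linarith) (by linarith)
      linarith
    have h2 : s / 8 ≤ Y * (s ^ 2 * (cscStep (m + 2) 2 / 4)) := by nlinarith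
    have h3 : 0 < s ^ 2 * (K * (1 - s) + radialSum (m + 2) (1 - s)) := by
      have := mul_le_mul_of_nonneg_left hA (sq_nonneg s)
      rw [mul_sub, e2] at this
      nlinarith
    exact pos_of_mul_pos_right h3 (sq_nonneg s)
  · have hB := cosSum_ge m (x := 1 - s) (by linarith)
    rw [hu, hD] at hB
    have e1 : 1 / √(1 + (1 - s) ^ 2) ^ 3 ≤ 1 := by
      rw [div_le_one₀ (by positivity)]
      exact le_trans (by nlinarith)
        (le_sqrt_cube (a := 1 + (1 - s) ^ 2) (b := 1) (by positivity) (by nlinarith))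
    have e2 : 0.089 + 0.07 * s ≤ 1 / √(5 - 4 * s) ^ 3 := by
      rw [le_div_iff₀ hw0]
      have : (0.089 + 0.07 * s) * √(5 - 4 * s) ^ 3 ≤ (0.089 + 0.07 * s) * (11.19 - 12.4 * s) := by
        gcongr
      nlinarith
    have e3 : s ^ 3 * (1 / (s * √(5 - 4 * s)) ^ 3) = 1 / √(5 - 4 * s) ^ 3 := by
      field_simp
    have hs3 : s ^ 3 ≤ 0.07 * s := by nlinarith [mul_nonneg hs0.le (sub_nonneg.2 hs1)]
    have h1 : 0.089 ≤ s ^ 3 * (1 / (s * √(5 - 4 * s)) ^ 3 - 1 / √(1 + (1 - s) ^ 2) ^ 3) := by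
      rw [mul_sub, e3]
      have := mul_le_mul_of_nonneg_left e1 (pow_nonneg hs0.le 3)
      linarith
    have h2 : 0.862 * 0.089 * 2 ≤ s ^ 3 * cosSum (m + 2) (1 - s) := by
      have := mul_le_mul_of_nonneg_left hB (pow_nonneg hs0.le 3)
      refine le_trans ?_ this
      have h5 : 0.862 ≤ 1 - 2 * s ^ 2 := by nlinarith
      nlinarith
    have h3 : 0.94 ≤ (1 - s) ^ 2 * (1 + (1 - s)) := by nlinarith
    have h4 : s * (1 + (1 - s) + (1 - s) ^ 2) ≤ 0.6 := by
      nlinarith [mul_nonneg hs0.le (sub_nonneg.2 hs1)]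
    have h5 : K * s ^ 2 * (s * (1 + (1 - s) + (1 - s) ^ 2)) ≤ 0.2037 * 0.6 := by
      apply mul_le_mul (by linarith) h4 (mul_nonneg hs0.le (by nlinarith)) (by norm_num)
    have h6 : 0.94 * (0.862 * 0.089 * 2) ≤
        (1 - s) ^ 2 * (1 + (1 - s)) * (s ^ 3 * cosSum (m + 2) (1 - s)) := by
      apply mul_le_mul h3 h2 (by norm_num) (by linarith)
    have h7 : s ^ 3 * (K * (1 + (1 - s) + (1 - s) ^ 2)) <
        s ^ 3 * ((1 - s) ^ 2 * (1 + (1 - s)) * cosSum (m + 2) (1 - s)) := by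
      norm_num at h5 h6
      linarith
    exact lt_of_mul_lt_mul_left h7 (by positivity)

/-- For `n > 3`, the function `h` takes a positive value at some point of `(0, 1)`. -/
theorem exists_hNum_pos {n : ℕ} (hn : 3 < n) {ε : ℝ} (hε : ε ∈ Set.Ioo (0 : ℝ) 1) :
    ∃ x ∈ Set.Ioo (0 : ℝ) 1, 0 < hNum n ε x := by
  obtain ⟨x, hx, hA, hB⟩ : ∃ x ∈ Set.Ioo (0 : ℝ) 1, 0 < n * kn n * x + radialSum n x ∧
      n * kn n * (1 + x + x ^ 2) < x ^ 2 * (1 + x) * cosSum n x := by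
    rcases (by omega : n = 4 ∨ n = 5 ∨ 6 ≤ n) with rfl | rfl | hn6
    · exact ⟨0.65, by norm_num, exists_point_four⟩
    · exact ⟨0.65, by norm_num, exists_point_five⟩
    · obtain ⟨m, rfl⟩ := Nat.exists_eq_add_of_le' (show 2 ≤ n by omega)
      exact exists_point_large m (by omega)
  exact ⟨x, hx, hNum_pos hε hx hA hB⟩

end

/-- Bifurcation: for `n > 3` and `ε ∈ (0,1)` there are `0 < μ₁ < μ₂` such that for
`μ ∈ (0, μ₁)` the equation `h(x, ε) = μ` has at least three solutions in
`(0,1) ∪ (1,∞)`, while for `μ > μ₂` it has exactly one solution there. -/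
theorem bifurcation (n : ℕ) (hn : 3 < n) (ε : ℝ) (hε : ε ∈ Set.Ioo (0 : ℝ) 1) :
    ∃ μ₁ μ₂ : ℝ, 0 < μ₁ ∧ μ₁ < μ₂ ∧
      (∀ μ ∈ Set.Ioo 0 μ₁, ∃ x y z : ℝ,
        x ∈ Set.Ioo (0 : ℝ) 1 ∪ Set.Ioi 1 ∧ y ∈ Set.Ioo (0 : ℝ) 1 ∪ Set.Ioi 1 ∧
        z ∈ Set.Ioo (0 : ℝ) 1 ∪ Set.Ioi 1 ∧ x ≠ y ∧ y ≠ z ∧ x ≠ z ∧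
        h n x ε = μ ∧ h n y ε = μ ∧ h n z ε = μ) ∧
      (∀ μ : ℝ, μ₂ < μ →
        ∃! x : ℝ, x ∈ Set.Ioo (0 : ℝ) 1 ∪ Set.Ioi 1 ∧ h n x ε = μ) := by
  obtain ⟨x₀, hx₀, hpos⟩ := exists_hNum_pos hn hε
  have hn2 : 2 ≤ n := by omega
  obtain ⟨μ₀, hμ₀⟩ := exists_unique_of_large hn2 hε
  have hh : 0 < h n x₀ ε := by
    rw [h_eq_hNum_div]
    exact div_pos hpos (sub_pos.2 (pow_lt_one₀ hx₀.1.le hx₀.2 (by norm_num)))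
  refine ⟨h n x₀ ε, max μ₀ (h n x₀ ε) + 1, hh, ?_, ?_, ?_⟩
  · linarith [le_max_right μ₀ (h n x₀ ε)]
  · rintro μ ⟨hμ0, hμ1⟩
    obtain ⟨x, y, hx, hy, hxy, hhx, hhy⟩ := exists_two_solutions_lt_one hn2 hε hμ0 hx₀ hμ1
    obtain ⟨z, hz, hhz⟩ := exists_solution_gt_one hn2 hε hμ0
    exact ⟨x, y, z, Or.inl hx, Or.inl hy, Or.inr hz, hxy.ne, (hy.2.trans hz).ne,
      (hx.2.trans hz).ne, hhx, hhy, hhz⟩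
  · intro μ hμ
    have h1 : μ₀ < μ := by linarith [le_max_left μ₀ (h n x₀ ε)]
    have h2 : 0 < μ := by linarith [le_max_right μ₀ (h n x₀ ε)]
    obtain ⟨z, hz, hhz⟩ := exists_solution_gt_one hn2 hε h2
    exact ⟨z, ⟨Or.inr hz, hhz⟩, fun y hy => hμ₀ μ y z h1 hy.1 (Or.inr hz) hy.2 hhz⟩
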